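/- Let q be a prime and suppose that for each prime p ≠ q a set A(p) ⊆ M^c(q) is given. Then d(q) ≤ 1 - (1 - 1/q) · ∏_{p prime, p ≠ q} [(1 - 1/p) · Σ_{a ∈ A(p)} 1/p^a]. -/

import Mathlib

open Filter Topology

/-- `TowerMem q n` means that the prime `q` occurs somewhere in the tower
factorization of the positive integer `n`:  `1 ∉ M(q)`, and for `n ≥ 2`,
`n ∈ M(q)` iff `q ∣ n` or some exponent in the prime factorization of `n`
lies in `M(q)`. -/
inductive TowerMem (q : ℕ) : ℕ → Prop
  | base (n : ℕ) (hn : 2 ≤ n) (hdvd : q ∣ n) : TowerMem q n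
  | step (n p : ℕ) (hn : 2 ≤ n) (hp : p.Prime) (hdvd : p ∣ n)
      (hexp : TowerMem q (n.factorization p)) : TowerMem q n

open Classical in
/-- The proportion of the integers `{1, …, N}` that lie in `M(q)`. -/
noncomputable def towerRatio (q N : ℕ) : ℝ :=
  (((Finset.Icc 1 N).filter fun n => TowerMem q n).card : ℝ) / (N : ℝ)

/-- The set `S` of natural numbers has natural density `δ`. -/
def HasNatDensity (S : Set ℕ) (δ : ℝ) : Prop :=
  Tendsto (fun N : ℕ => (∑ n ∈ Finset.Icc 1 N, S.indicator (fun _ => (1 : ℝ)) n) / (N : ℝ))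
    atTop (𝓝 δ)

namespace HasNatDensity

theorem positive : HasNatDensity {n | 0 < n} 1 := by
  refine tendsto_const_nhds.congr' ?_
  filter_upwards [eventually_gt_atTop 0] with N hN
  have h : ∑ n ∈ Finset.Icc 1 N, ({n | 0 < n} : Set ℕ).indicator (fun _ => (1 : ℝ)) n = N := by
    rw [Finset.sum_congr rfl (g := fun _ => (1 : ℝ))]
    · simp
    · intro n hn
      exact Set.indicator_of_mem (Finset.mem_Icc.1 hn).1 _
  rw [h, div_self (by positivity)]

theorem mul_image {S : Set ℕ} {δ : ℝ} (h : HasNatDensity S δ) {k : ℕ} (hk : 0 < k) :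
    HasNatDensity ((k * ·) '' S) (δ / k) := by
  have hinj : Function.Injective (k * · : ℕ → ℕ) := fun a b hab => Nat.eq_of_mul_eq_mul_left hk hab
  have hsum (N : ℕ) : ∑ n ∈ Finset.Icc 1 N, ((k * ·) '' S).indicator (fun _ => (1 : ℝ)) n =
      ∑ n ∈ Finset.Icc 1 (N / k), S.indicator (fun _ => (1 : ℝ)) n := by
    have h1 : ∑ n ∈ Finset.Icc 1 (N / k), S.indicator (fun _ => (1 : ℝ)) n =
        ∑ n ∈ (Finset.Icc 1 (N / k)).image (k * ·),
          ((k * ·) '' S).indicator (fun _ => (1 : ℝ)) n := by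
      rw [Finset.sum_image fun a _ b _ hab => hinj hab]
      refine Finset.sum_congr rfl fun n _ => ?_
      by_cases hn : n ∈ S
      · rw [Set.indicator_of_mem hn, Set.indicator_of_mem (Set.mem_image_of_mem _ hn)]
      · rw [Set.indicator_of_notMem hn,
          Set.indicator_of_notMem (fun hn' => hn ((hinj.mem_set_image).1 hn'))]
    rw [h1]
    symm
    apply Finset.sum_subset
    · intro n hn
      obtain ⟨m, hm, rfl⟩ := Finset.mem_image.1 hn
      rw [Finset.mem_Icc] at hm ⊢
      exact ⟨Nat.mul_pos hk hm.1, (Nat.mul_le_mul_left k hm.2).trans (Nat.mul_div_le N k)⟩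
    · intro n hn hn'
      refine Set.indicator_of_notMem ?_ _
      rintro ⟨m, -, rfl⟩
      rw [Finset.mem_Icc] at hn
      refine hn' (Finset.mem_image_of_mem _ (Finset.mem_Icc.2 ⟨?_, ?_⟩))
      · exact Nat.pos_of_mul_pos_left hn.1
      · rw [Nat.le_div_iff_mul_le hk, mul_comm]
        exact hn.2
  have hdiv : Tendsto (fun N : ℕ => ((N / k : ℕ) : ℝ) / N) atTop (𝓝 (1 / k)) := by
    have h1 := (tendsto_nat_floor_mul_div_atTop (R := ℝ) (a := 1 / k) (by positivity)).comp
      tendsto_natCast_atTop_atTop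
    refine h1.congr fun N => ?_
    simp only [Function.comp]
    rw [one_div_mul_eq_div, Nat.floor_div_natCast, Nat.floor_natCast]
  have hlim := (h.comp (Nat.tendsto_div_const_atTop hk.ne')).mul hdiv
  rw [mul_one_div] at hlim
  refine hlim.congr' ?_
  filter_upwards [eventually_ge_atTop k] with N hN
  have h0 : ((N / k : ℕ) : ℝ) ≠ 0 := by
    exact_mod_cast (Nat.div_pos hN hk).ne'
  simp only [Function.comp, hsum]
  field_simp

theorem diff {S T : Set ℕ} {δ ε : ℝ} (hS : HasNatDensity S δ) (hT : HasNatDensity T ε)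
    (hTS : T ⊆ S) : HasNatDensity (S \ T) (δ - ε) := by
  refine (hS.sub hT).congr fun N => ?_
  rw [← sub_div, ← Finset.sum_sub_distrib, Set.indicator_sdiff hTS]
  rfl

theorem biUnion {ι : Type*} {B : Finset ι} {S : ι → Set ℕ} {δ : ι → ℝ}
    (h : ∀ a ∈ B, HasNatDensity (S a) (δ a)) (hd : (B : Set ι).PairwiseDisjoint S) :
    HasNatDensity (⋃ a ∈ B, S a) (∑ a ∈ B, δ a) := by
  refine (tendsto_finsetSum B h).congr fun N => ?_
  rw [← Finset.sum_div, Finset.sum_comm, Finset.indicator_biUnion B S hd]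

/-- The density of the set of positive integers whose valuation at each of finitely many
primes is constrained to a finite set. -/
theorem factorization_mem (B : ℕ → Finset ℕ) (F : Finset ℕ) (hF : ∀ p ∈ F, p.Prime) :
    HasNatDensity {n | 0 < n ∧ ∀ p ∈ F, n.factorization p ∈ B p}
      (∏ p ∈ F, ((1 - 1 / (p : ℝ)) * ∑ a ∈ B p, 1 / (p : ℝ) ^ a)) := by
  induction F using Finset.induction_on with
  | empty => simpa using positive
  | insert p F hpF ih =>
    have hp : p.Prime := hF p (Finset.mem_insert_self p F)
    have hF' : ∀ r ∈ F, r.Prime := fun r hr => hF r (Finset.mem_insert_of_mem hr)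
    specialize ih hF'
    set T : Set ℕ := {n | 0 < n ∧ ∀ p ∈ F, n.factorization p ∈ B p}
    have hfac {a m r : ℕ} (hm : 0 < m) (hr : r ∈ F) :
        (p ^ a * m).factorization r = m.factorization r := by
      have hrp : p ≠ r := fun h => hpF (h ▸ hr)
      rw [Nat.factorization_mul (pow_pos hp.pos a).ne' hm.ne', hp.factorization_pow]
      simp [hrp]
    have hmem {a m : ℕ} : p ^ a * m ∈ T ↔ m ∈ T := by
      constructor
      · rintro ⟨h0, h⟩
        have hm : 0 < m := Nat.pos_of_mul_pos_left h0
        exact ⟨hm, fun r hr => hfac (a := a) hm hr ▸ h r hr⟩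
      · rintro ⟨h0, h⟩
        exact ⟨Nat.mul_pos (pow_pos hp.pos a) h0, fun r hr => (hfac h0 hr).symm ▸ h r hr⟩
    have hsub : (p * ·) '' T ⊆ T := by
      rintro _ ⟨m, hm, rfl⟩
      simpa using (hmem (a := 1)).2 hm
    have hU := ih.diff (ih.mul_image hp.pos) hsub
    have hUmem {m : ℕ} : m ∈ T \ (p * ·) '' T ↔ m ∈ T ∧ ¬ p ∣ m := by
      refine ⟨fun h => ⟨h.1, ?_⟩, fun h => ⟨h.1, ?_⟩⟩
      · rintro ⟨k, rfl⟩
        exact h.2 ⟨k, (hmem (a := 1)).1 (by simpa using h.1), rfl⟩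
      · rintro ⟨k, -, rfl⟩
        exact h.2 (dvd_mul_right p k)
    set U := T \ (p * ·) '' T
    have hval {a m : ℕ} (hm : m ∈ U) : (p ^ a * m).factorization p = a := by
      obtain ⟨hmT, hpm⟩ := hUmem.1 hm
      rw [Nat.factorization_mul (pow_pos hp.pos a).ne' hmT.1.ne', hp.factorization_pow]
      simp [Nat.factorization_eq_zero_of_not_dvd hpm]
    have key := biUnion (B := B p) (S := fun a => (p ^ a * ·) '' U)
      (fun a _ => hU.mul_image (pow_pos hp.pos a)) (by
        intro a _ b _ hab
        refine Set.disjoint_left.2 ?_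
        rintro _ ⟨m, hm, rfl⟩ ⟨m', hm', h⟩
        refine hab ?_
        rw [← hval (a := a) hm, ← hval (a := b) hm']
        exact congrArg (fun n => n.factorization p) h.symm)
    convert key using 1
    · ext n
      simp only [Set.mem_ofPred_eq, Set.mem_iUnion, Finset.forall_mem_insert]
      constructor
      · rintro ⟨h0, hnp, hn⟩
        refine ⟨_, hnp, n / p ^ n.factorization p, hUmem.2 ⟨?_, ?_⟩,
          Nat.ordProj_mul_ordCompl_eq_self n p⟩
        · rw [← hmem (a := n.factorization p), Nat.ordProj_mul_ordCompl_eq_self]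
          exact ⟨h0, hn⟩
        · exact Nat.not_dvd_ordCompl hp h0.ne'
      · rintro ⟨a, ha, m, hm, rfl⟩
        obtain ⟨h0, h⟩ := hmem.2 (hUmem.1 hm).1
        exact ⟨h0, (hval hm).symm ▸ ha, h⟩
    · rw [Finset.prod_insert hpF, Finset.mul_sum, Finset.sum_mul]
      refine Finset.sum_congr rfl fun a _ => ?_
      push_cast
      ring

end HasNatDensity

theorem not_towerMem_of_le_one {q m : ℕ} (hm : m ≤ 1) : ¬ TowerMem q m := by
  rintro (⟨_, h, _⟩ | ⟨_, _, h, _, _, _⟩) <;> omega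

/-- Membership in `M(q)` is detected by the primes of a finite set `F ∋ q`, or forces a square
factor `p ^ 2` with `p ∉ F`. -/
theorem TowerMem.exists_sq_dvd {q n : ℕ} {F : Finset ℕ} {B : ℕ → Finset ℕ} (hq : q.Prime)
    (hqF : q ∈ F) (hBq : B q = {0}) (hB : ∀ p ∈ F, ∀ a ∈ B p, ¬ TowerMem q a)
    (hn : ∀ p ∈ F, n.factorization p ∈ B p) (h : TowerMem q n) :
    ∃ p, p.Prime ∧ p ∉ F ∧ p ^ 2 ∣ n := by
  rcases h with ⟨_, h2, hdvd⟩ | ⟨_, p, h2, hp, hdvd, hexp⟩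
  · have h0 := hn q hqF
    rw [hBq, Finset.mem_singleton] at h0
    exact absurd h0 (hq.factorization_pos_of_dvd (by omega) hdvd).ne'
  · refine ⟨p, hp, fun hpF => hB p hpF _ (hn p hpF) hexp, ?_⟩
    rw [hp.pow_dvd_iff_le_factorization (by omega)]
    by_contra hlt
    exact not_towerMem_of_le_one (by omega) hexp

theorem sum_indicator_dvd (k N : ℕ) :
    ∑ n ∈ Finset.Icc 1 N, {n | k ∣ n}.indicator (fun _ => (1 : ℝ)) n ≤ N / (k : ℝ) := by
  classical
  simp only [Set.indicator_apply, Set.mem_ofPred_eq]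
  rw [Finset.sum_boole]
  have h : ((Finset.Icc 1 N).filter (k ∣ ·)).card = N / k := Nat.Ioc_filter_dvd_card_eq_div N k
  rw [h]
  exact Nat.cast_div_le

theorem towerRatio_add_le {q P N : ℕ} (hP : 0 < P) (hN : 0 < N) {S : Set ℕ}
    (hS : ∀ n ∈ S, TowerMem q n → ∃ p, P < p ∧ p ^ 2 ∣ n) :
    towerRatio q N + (∑ n ∈ Finset.Icc 1 N, S.indicator (fun _ => (1 : ℝ)) n) / (N : ℝ) ≤
      1 + 1 / P := by
  classical
  have hpt : ∀ n ∈ Finset.Icc 1 N, (if TowerMem q n then (1 : ℝ) else 0) +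
      S.indicator (fun _ => (1 : ℝ)) n ≤
      1 + ∑ p ∈ Finset.Ioc P (max P N), {n | p ^ 2 ∣ n}.indicator (fun _ => (1 : ℝ)) n := by
    intro n hn
    have hnn (p : ℕ) : 0 ≤ {n | p ^ 2 ∣ n}.indicator (fun _ => (1 : ℝ)) n :=
      Set.indicator_nonneg (fun _ _ => zero_le_one) n
    have hsum : 0 ≤ ∑ p ∈ Finset.Ioc P (max P N), {n | p ^ 2 ∣ n}.indicator (fun _ => (1 : ℝ)) n :=
      Finset.sum_nonneg fun p _ => hnn p
    by_cases hnS : n ∈ S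
    · rw [Set.indicator_of_mem hnS]
      split_ifs with hT
      · obtain ⟨p, hPp, hpn⟩ := hS n hnS hT
        rw [Finset.mem_Icc] at hn
        have hpN : p ≤ N := by
          have := Nat.le_of_dvd hn.1 hpn
          nlinarith
        have h1 := Finset.single_le_sum (f := fun p : ℕ =>
          {n | p ^ 2 ∣ n}.indicator (fun _ => (1 : ℝ)) n) (fun p _ => hnn p)
          (Finset.mem_Ioc.2 ⟨hPp, hpN.trans (le_max_right P N)⟩)
        rw [Set.indicator_of_mem (show n ∈ {n | p ^ 2 ∣ n} from hpn)] at h1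
        linarith
      · linarith
    · rw [Set.indicator_of_notMem hnS]
      split_ifs <;> linarith
  have h := Finset.sum_le_sum hpt
  rw [Finset.sum_add_distrib, Finset.sum_add_distrib, Finset.sum_comm, Finset.sum_boole] at h
  have htail : ∑ p ∈ Finset.Ioc P (max P N), ∑ n ∈ Finset.Icc 1 N,
      {n | p ^ 2 ∣ n}.indicator (fun _ => (1 : ℝ)) n ≤ N * (1 / P) := by
    calc _ ≤ ∑ p ∈ Finset.Ioc P (max P N), (N : ℝ) * ((p : ℝ) ^ 2)⁻¹ := by
          refine Finset.sum_le_sum fun p hp => ?_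
          have hp0 : 0 < p := hP.trans (Finset.mem_Ioc.1 hp).1
          refine (sum_indicator_dvd (p ^ 2) N).trans_eq ?_
          push_cast
          rfl
      _ ≤ N * (1 / P) := by
          rw [← Finset.mul_sum]
          gcongr
          refine (sum_Ioc_inv_sq_le_sub hP.ne' (le_max_left P N)).trans ?_
          rw [one_div]
          exact sub_le_self _ (by positivity)
  have hN' : (0 : ℝ) < N := by exact_mod_cast hN
  have hcard : ∑ n ∈ Finset.Icc 1 N, (1 : ℝ) = N := by simp
  rw [towerRatio, ← add_div, div_le_iff₀ hN']
  convert (h.trans (add_le_add hcard.le htail)) using 1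
  · ring

theorem hasSum_one_div_pow {p : ℕ} (hp : p.Prime) :
    HasSum (fun a : ℕ => 1 / (p : ℝ) ^ a) (1 - 1 / (p : ℝ))⁻¹ := by
  have h1 : (1 : ℝ) < p := by exact_mod_cast hp.one_lt
  simpa only [one_div, inv_pow] using
    hasSum_geometric_of_lt_one (inv_nonneg.2 (by positivity)) (inv_lt_one_of_one_lt₀ h1)

/-- The local density at `p` of the integers whose `p`-adic valuation lies in `A`. -/
noncomputable def localDensity (p : ℕ) (A : Set ℕ) : ℝ :=
  (1 - 1 / (p : ℝ)) * ∑' a : A, 1 / (p : ℝ) ^ (a : ℕ)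

theorem one_sub_one_div_prime_pos {p : ℕ} (hp : p.Prime) : 0 < 1 - 1 / (p : ℝ) := by
  have h1 : (1 : ℝ) < p := by exact_mod_cast hp.one_lt
  rw [sub_pos, div_lt_one (by positivity)]
  exact h1

theorem localDensity_nonneg {p : ℕ} (hp : p.Prime) (A : Set ℕ) : 0 ≤ localDensity p A :=
  mul_nonneg (one_sub_one_div_prime_pos hp).le (tsum_nonneg fun _ => by positivity)

theorem localDensity_le_one {p : ℕ} (hp : p.Prime) (A : Set ℕ) : localDensity p A ≤ 1 := by
  have h := hasSum_one_div_pow hp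
  have hpos := one_sub_one_div_prime_pos hp
  calc localDensity p A ≤ (1 - 1 / (p : ℝ)) * (1 - 1 / (p : ℝ))⁻¹ := by
        refine mul_le_mul_of_nonneg_left ?_ hpos.le
        rw [← h.tsum_eq]
        exact h.summable.tsum_subtype_le _ A (fun _ => by positivity)
    _ = 1 := mul_inv_cancel₀ hpos.ne'

open Classical in
theorem tendsto_localDensity {p : ℕ} (hp : p.Prime) (A : Set ℕ) :
    Tendsto (fun K : ℕ => (1 - 1 / (p : ℝ)) *
      ∑ a ∈ (Finset.range K).filter (· ∈ A), 1 / (p : ℝ) ^ a) atTop (𝓝 (localDensity p A)) := by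
  refine Tendsto.const_mul _ ?_
  rw [tsum_subtype A fun a : ℕ => 1 / (p : ℝ) ^ a]
  refine ((hasSum_one_div_pow hp).summable.indicator A).hasSum.tendsto_sum_nat.congr fun K => ?_
  rw [Finset.sum_filter]
  rfl

theorem tprod_le_prod_of_le_one {ι : Type*} {f : ι → ℝ} (h0 : ∀ i, 0 ≤ f i) (h1 : ∀ i, f i ≤ 1)
    (s : Finset ι) : ∏' i, f i ≤ ∏ i ∈ s, f i := by
  have hanti : Antitone fun s : Finset ι => ∏ i ∈ s, f i := fun s t hst =>
    Finset.prod_le_prod_of_subset_of_le_one hst (fun i _ => h0 i) (fun i _ _ => h1 i)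
  have hbdd : BddBelow (Set.range fun s : Finset ι => ∏ i ∈ s, f i) :=
    ⟨0, by rintro _ ⟨s, rfl⟩; exact Finset.prod_nonneg fun i _ => h0 i⟩
  have hprod : HasProd f (⨅ s : Finset ι, ∏ i ∈ s, f i) := tendsto_atTop_ciInf hanti hbdd
  rw [hprod.tprod_eq]
  exact ciInf_le hbdd s

open Classical in
theorem le_one_sub_prod_add {q : ℕ} (hq : q.Prime) {A : ℕ → Set ℕ}
    (hA : ∀ p : ℕ, p.Prime → p ≠ q → A p ⊆ {m | ¬ TowerMem q m}) {d : ℝ}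
    (hd : Tendsto (towerRatio q) atTop (𝓝 d)) {P : ℕ} (hP : q ≤ P) :
    d ≤ 1 - (1 - 1 / (q : ℝ)) *
      ∏ p ∈ (Finset.range (P + 1)).filter (fun p => p.Prime ∧ p ≠ q), localDensity p (A p) +
      1 / P := by
  set G := (Finset.range (P + 1)).filter (fun p => p.Prime ∧ p ≠ q)
  have hGmem {p : ℕ} (hp : p ∈ G) : p.Prime ∧ p ≠ q := (Finset.mem_filter.1 hp).2
  have hqG : q ∉ G := fun h => (hGmem h).2 rfl
  have hlim : Tendsto (fun K : ℕ => (1 - 1 / (q : ℝ)) * ∏ p ∈ G, ((1 - 1 / (p : ℝ)) *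
      ∑ a ∈ (Finset.range K).filter (· ∈ A p), 1 / (p : ℝ) ^ a)) atTop
      (𝓝 ((1 - 1 / (q : ℝ)) * ∏ p ∈ G, localDensity p (A p))) :=
    (tendsto_finsetProd G fun p hp => tendsto_localDensity (hGmem hp).1 (A p)).const_mul _
  suffices h : ∀ K : ℕ, (1 - 1 / (q : ℝ)) * ∏ p ∈ G, ((1 - 1 / (p : ℝ)) *
      ∑ a ∈ (Finset.range K).filter (· ∈ A p), 1 / (p : ℝ) ^ a) ≤ 1 + 1 / P - d by
    linarith [le_of_tendsto' hlim h]
  intro K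
  let B : ℕ → Finset ℕ := fun p => if p = q then {0} else (Finset.range K).filter (· ∈ A p)
  have hBq : B q = {0} := if_pos rfl
  have hBG {p : ℕ} (hp : p ∈ G) : B p = (Finset.range K).filter (· ∈ A p) :=
    if_neg (hGmem hp).2
  have hB : ∀ p ∈ insert q G, ∀ a ∈ B p, ¬ TowerMem q a := by
    intro p hp a ha
    rcases Finset.mem_insert.1 hp with rfl | hp
    · rw [hBq, Finset.mem_singleton] at ha
      exact not_towerMem_of_le_one (by omega)
    · rw [hBG hp, Finset.mem_filter] at ha
      exact hA p (hGmem hp).1 (hGmem hp).2 ha.2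
  have hdens := HasNatDensity.factorization_mem B (insert q G) (by
    intro p hp
    rcases Finset.mem_insert.1 hp with rfl | hp
    exacts [hq, (hGmem hp).1])
  rw [Finset.prod_insert hqG, hBq, Finset.sum_singleton, pow_zero, div_one, mul_one,
    Finset.prod_congr rfl fun p hp => by rw [hBG hp]] at hdens
  have hle := le_of_tendsto (hd.add hdens) (b := 1 + 1 / (P : ℝ)) (by
    filter_upwards [eventually_gt_atTop 0] with N hN
    refine towerRatio_add_le (hq.pos.trans_le hP) hN fun n hn hT => ?_
    obtain ⟨p, hp, hpF, hpn⟩ :=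
      TowerMem.exists_sq_dvd hq (Finset.mem_insert_self q G) hBq hB hn.2 hT
    refine ⟨p, ?_, hpn⟩
    by_contra hle
    refine hpF (Finset.mem_insert.2 (or_iff_not_imp_left.2 fun hpq => ?_))
    exact Finset.mem_filter.2 ⟨Finset.mem_range.2 (by omega), hp, hpq⟩)
  linarith

theorem tower_density_upper_bound_compl_subsets (q : ℕ) (hq : q.Prime)
    (A : ℕ → Set ℕ) (hA : ∀ p : ℕ, p.Prime → p ≠ q → A p ⊆ {m | ¬ TowerMem q m})
    (d : ℝ) (hd : Tendsto (towerRatio q) atTop (𝓝 d)) :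
    d ≤ 1 - (1 - 1 / (q : ℝ)) *
      ∏' p : {p : ℕ // p.Prime ∧ p ≠ q},
        ((1 - 1 / ((p : ℕ) : ℝ)) *
          ∑' a : A (p : ℕ), 1 / ((p : ℕ) : ℝ) ^ (a : ℕ)) := by
  classical
  change d ≤ 1 - (1 - 1 / (q : ℝ)) *
    ∏' p : {p : ℕ // p.Prime ∧ p ≠ q}, localDensity p (A p)
  have hlim : Tendsto (fun P : ℕ => 1 - (1 - 1 / (q : ℝ)) *
      ∏' p : {p : ℕ // p.Prime ∧ p ≠ q}, localDensity p (A p) + 1 / (P : ℝ)) atTop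
      (𝓝 (1 - (1 - 1 / (q : ℝ)) *
        ∏' p : {p : ℕ // p.Prime ∧ p ≠ q}, localDensity p (A p) + 0)) :=
    tendsto_one_div_atTop_nhds_zero_nat.const_add _
  rw [add_zero] at hlim
  refine ge_of_tendsto hlim ?_
  filter_upwards [eventually_ge_atTop q] with P hP
  refine (le_one_sub_prod_add hq hA hd hP).trans ?_
  have hle := tprod_le_prod_of_le_one
    (f := fun p : {p : ℕ // p.Prime ∧ p ≠ q} => localDensity p (A p))
    (fun p => localDensity_nonneg p.2.1 _) (fun p => localDensity_le_one p.2.1 _)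
    ((Finset.range (P + 1)).subtype _)
  rw [Finset.prod_subtype_eq_prod_filter (fun p => localDensity p (A p))] at hle
  have hpos := one_sub_one_div_prime_pos hq
  gcongr
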